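/- arXiv:math/0612431 — 2 statements merged into one kernel-verified Lean document; each statement's English description precedes it below -/
import Mathlib

section
/- For all m,n ≥ 1: d₁ maps Hom_poly(B^{⊗m}, B^{⊗n}) into Hom_poly(B^{⊗(m+1)}, B^{⊗n}), and d₂ maps Hom_poly(B^{⊗m}, B^{⊗n}) into Hom_poly(B^{⊗m}, B^{⊗(n+1)}). Hence ⊕_{m,n≥1} Hom_poly(B^{⊗m}, B^{⊗n}) is a subcomplex of the Gerstenhaber–Schack complex of the bialgebra B (Lemma 4.1 of the paper). -/
noncomputable section

open MvPolynomial

namespace GS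

variable (k : Type) [Field k] [CharZero k] (N : ℕ)

/-- Model of `B^{⊗n}` where `B = k[x¹,…,x^N]`: polynomials in `n` groups ("slots")
of `N` variables; the slot-`t` variables model the `t`-th tensor factor. -/
abbrev Pn (n : ℕ) : Type := MvPolynomial (Fin n × Fin N) k

/-- The iterated comultiplication `Δ^{n-1} : B → B^{⊗n}`, the algebra map `x_i ↦ Σ_t x_{(t,i)}`. -/
def Δiter (n : ℕ) : MvPolynomial (Fin N) k →ₐ[k] Pn k N n :=
  MvPolynomial.aeval fun i => ∑ t : Fin n, MvPolynomial.X (t, i)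

/-- The algebra map `B^{⊗m} → B^{⊗n}` applying `Δ^{n-1}` to every tensor factor and
multiplying the results in `B^{⊗n}`. -/
def spread (m n : ℕ) : Pn k N m →ₐ[k] Pn k N n :=
  MvPolynomial.aeval fun p => ∑ t : Fin n, MvPolynomial.X (t, p.2)

/-- The operator `∂^{I_1} ⊗ ⋯ ⊗ ∂^{I_m}` on `B^{⊗m}`. -/
def derivOp (m : ℕ) (Is : Fin m → List (Fin N)) : Pn k N m →ₗ[k] Pn k N m :=
  ((List.finRange m).flatMap fun s => (Is s).map fun i => ((s, i) : Fin m × Fin N)).foldr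
    (fun p g => (MvPolynomial.pderiv p).toLinearMap.comp g) LinearMap.id

/-- The prefactor `x^{J_1} ⊗ ⋯ ⊗ x^{J_n} ∈ B^{⊗n}`. -/
def xMon (n : ℕ) (Js : Fin n → List (Fin N)) : Pn k N n :=
  ∏ t : Fin n, ((Js t).map fun i => (MvPolynomial.X (t, i) : Pn k N n)).prod

/-- The basic polydifferential operator `Γ^{J_1…J_n}_{I_1…I_m} : B^{⊗m} → B^{⊗n}`,
`f₁⊗…⊗f_m ↦ (x^{J_1}⊗…⊗x^{J_n}) ⋅ Δ^{n-1}(∂^{I_1}f_1) ⋯ Δ^{n-1}(∂^{I_m}f_m)`. -/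
def Γop (m n : ℕ) (Is : Fin m → List (Fin N)) (Js : Fin n → List (Fin N)) :
    Pn k N m →ₗ[k] Pn k N n :=
  (LinearMap.mulLeft k (xMon k N n Js)) ∘ₗ (spread k N m n).toLinearMap ∘ₗ derivOp k N m Is

/-- `Hom_poly(B^{⊗m}, B^{⊗n})`: the linear span of the basic polydifferential operators. -/
def polyHom (m n : ℕ) : Submodule k (Pn k N m →ₗ[k] Pn k N n) :=
  Submodule.span k {g | ∃ Is Js, g = Γop k N m n Is Js}

/-- Exponents of the slot-0 part of a monomial of `B^{⊗(m+1)}`. -/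
def frontExp (m : ℕ) (μ : (Fin (m + 1) × Fin N) →₀ ℕ) : Fin N →₀ ℕ :=
  Finsupp.comapDomain (fun i => ((0 : Fin (m + 1)), i)) μ
    (fun a _ b _ h => by simpa using h)

/-- Exponents of the slots `1,…,m` part of a monomial of `B^{⊗(m+1)}`. -/
def restExp (m : ℕ) (μ : (Fin (m + 1) × Fin N) →₀ ℕ) : (Fin m × Fin N) →₀ ℕ :=
  Finsupp.comapDomain (fun p : Fin m × Fin N => (p.1.succ, p.2)) μ
    (fun a _ b _ h => by
      rcases a with ⟨a1, a2⟩; rcases b with ⟨b1, b2⟩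
      simp only [Prod.mk.injEq] at h ⊢
      exact ⟨Fin.succ_inj.mp h.1, h.2⟩)

/-- Exponents of the last-slot part of a monomial of `B^{⊗(m+1)}`. -/
def lastExp (m : ℕ) (μ : (Fin (m + 1) × Fin N) →₀ ℕ) : Fin N →₀ ℕ :=
  Finsupp.comapDomain (fun i => ((Fin.last m : Fin (m + 1)), i)) μ
    (fun a _ b _ h => by simpa using h)

/-- Exponents of the slots `0,…,m-1` part of a monomial of `B^{⊗(m+1)}`. -/
def initExp (m : ℕ) (μ : (Fin (m + 1) × Fin N) →₀ ℕ) : (Fin m × Fin N) →₀ ℕ :=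
  Finsupp.comapDomain (fun p : Fin m × Fin N => (p.1.castSucc, p.2)) μ
    (fun a _ b _ h => by
      rcases a with ⟨a1, a2⟩; rcases b with ⟨b1, b2⟩
      simp only [Prod.mk.injEq] at h ⊢
      exact ⟨Fin.castSucc_inj.mp h.1, h.2⟩)

/-- The term `v₀ ⊗ v₁ ⊗ … ⊗ v_m ↦ Δ^{n-1}(v₀) ⋅ f(v₁ ⊗ … ⊗ v_m)` of the
Gerstenhaber–Schack differential `d₁`. -/
def termA (m n : ℕ) (f : Pn k N m →ₗ[k] Pn k N n) : Pn k N (m + 1) →ₗ[k] Pn k N n :=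
  (MvPolynomial.basisMonomials (Fin (m + 1) × Fin N) k).constr k fun μ =>
    (Δiter k N n) (MvPolynomial.monomial (frontExp N m μ) 1) *
      f (MvPolynomial.monomial (restExp N m μ) 1)

/-- The term `v₀ ⊗ … ⊗ v_m ↦ f(v₀ ⊗ … ⊗ v_{m-1}) ⋅ Δ^{n-1}(v_m)`. -/
def termC (m n : ℕ) (f : Pn k N m →ₗ[k] Pn k N n) : Pn k N (m + 1) →ₗ[k] Pn k N n :=
  (MvPolynomial.basisMonomials (Fin (m + 1) × Fin N) k).constr k fun μ =>
    f (MvPolynomial.monomial (initExp N m μ) 1) *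
      (Δiter k N n) (MvPolynomial.monomial (lastExp N m μ) 1)

/-- The Gerstenhaber–Schack differential `d₁` (Hochschild differential of the algebra `B`
with values in the `B`-bimodule `B^{⊗n}`). -/
def d1 (m n : ℕ) (f : Pn k N m →ₗ[k] Pn k N n) : Pn k N (m + 1) →ₗ[k] Pn k N n :=
  termA k N m n f
    + ∑ i : Fin m, ((-1 : k) ^ ((i : ℕ) + 1)) •
        (f ∘ₗ (MvPolynomial.rename (Prod.map i.predAbove id)).toLinearMap)
    + ((-1 : k) ^ (m + 1)) • termC k N m n f

/-- The left `B`-comodule structure `λ : B^{⊗m} → B ⊗ B^{⊗m}` (the extra `B`-factor is slot `0`). -/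
def lam (m : ℕ) : Pn k N m →ₐ[k] Pn k N (m + 1) :=
  MvPolynomial.aeval fun p =>
    MvPolynomial.X ((0 : Fin (m + 1)), p.2) + MvPolynomial.X (p.1.succ, p.2)

/-- The right `B`-comodule structure `ρ : B^{⊗m} → B^{⊗m} ⊗ B` (the extra `B`-factor is the last slot). -/
def rhoC (m : ℕ) : Pn k N m →ₐ[k] Pn k N (m + 1) :=
  MvPolynomial.aeval fun p =>
    MvPolynomial.X (p.1.castSucc, p.2) + MvPolynomial.X ((Fin.last m : Fin (m + 1)), p.2)

/-- The map `id_B ⊗ f : B ⊗ B^{⊗m} → B ⊗ B^{⊗n}` (extra factors in slot `0`). -/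
def lextend (m n : ℕ) (f : Pn k N m →ₗ[k] Pn k N n) :
    Pn k N (m + 1) →ₗ[k] Pn k N (n + 1) :=
  (MvPolynomial.basisMonomials (Fin (m + 1) × Fin N) k).constr k fun μ =>
    (MvPolynomial.monomial (Finsupp.mapDomain (fun i => ((0 : Fin (n + 1)), i)) (frontExp N m μ))
        (1 : k)) *
      (MvPolynomial.rename (Prod.map Fin.succ (id : Fin N → Fin N)))
        (f (MvPolynomial.monomial (restExp N m μ) 1))

/-- The map `f ⊗ id_B : B^{⊗m} ⊗ B → B^{⊗n} ⊗ B` (extra factors in the last slot). -/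
def rextend (m n : ℕ) (f : Pn k N m →ₗ[k] Pn k N n) :
    Pn k N (m + 1) →ₗ[k] Pn k N (n + 1) :=
  (MvPolynomial.basisMonomials (Fin (m + 1) × Fin N) k).constr k fun μ =>
    (MvPolynomial.rename (Prod.map Fin.castSucc (id : Fin N → Fin N)))
        (f (MvPolynomial.monomial (initExp N m μ) 1)) *
      (MvPolynomial.monomial
        (Finsupp.mapDomain (fun i => ((Fin.last n : Fin (n + 1)), i)) (lastExp N m μ)) (1 : k))

/-- The map `id^{⊗i} ⊗ Δ ⊗ id^{⊗(n-1-i)} : B^{⊗n} → B^{⊗(n+1)}` splitting slot `i`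
into slots `i, i+1`. -/
def coface (n : ℕ) (i : Fin n) : Pn k N n →ₐ[k] Pn k N (n + 1) :=
  MvPolynomial.aeval fun p =>
    if p.1 = i then
      MvPolynomial.X ((i.castSucc : Fin (n + 1)), p.2) + MvPolynomial.X (i.succ, p.2)
    else MvPolynomial.X (i.castSucc.succAbove p.1, p.2)

/-- The Gerstenhaber–Schack differential `d₂` (dual co-Hochschild differential of the
coalgebra `B` with values in the `B`-bicomodule `B^{⊗m}`). -/
def d2 (m n : ℕ) (f : Pn k N m →ₗ[k] Pn k N n) : Pn k N m →ₗ[k] Pn k N (n + 1) :=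
  (lextend k N m n f) ∘ₗ (lam k N m).toLinearMap
    + ∑ i : Fin n, ((-1 : k) ^ ((i : ℕ) + 1)) • ((coface k N n i).toLinearMap ∘ₗ f)
    + ((-1 : k) ^ (n + 1)) • ((rextend k N m n f) ∘ₗ (rhoC k N m).toLinearMap)

section General

variable {R σ τ : Type} [CommRing R]

lemma commute_pderiv (p q : σ) :
    Commute (pderiv p : Derivation R (MvPolynomial σ R) _).toLinearMap
      (pderiv q : Derivation R (MvPolynomial σ R) _).toLinearMap := by
  classical
  have h : ⁅(pderiv p : Derivation R (MvPolynomial σ R) (MvPolynomial σ R)),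
      (pderiv q : Derivation R (MvPolynomial σ R) (MvPolynomial σ R))⁆ = 0 := by
    refine derivation_ext fun i => ?_
    simp only [Derivation.commutator_apply, pderiv_X, Pi.single_apply]
    split_ifs <;> simp
  refine LinearMap.ext fun P => sub_eq_zero.mp ?_
  simpa [Derivation.commutator_apply] using DFunLike.congr_fun h P

lemma pderiv_rename_eq_sum [Fintype σ] [DecidableEq τ] (f : σ → τ) (t : τ)
    (P : MvPolynomial σ R) :
    pderiv t (rename f P) = ∑ s with f s = t, rename f (pderiv s P) := by
  classical
  induction P using MvPolynomial.induction_on with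
  | C a => simp
  | add P Q hP hQ => simp [hP, hQ, Finset.sum_add_distrib]
  | mul_X P s h =>
    simp only [map_mul, rename_X, Derivation.leibniz, smul_eq_mul, h, pderiv_X, map_add,
      Finset.sum_add_distrib, Pi.single_apply, Finset.mul_sum]
    simp [apply_ite, Finset.sum_filter]

lemma pderiv_rename_of_forall_ne (f : σ → τ) (t : τ) (h : ∀ s, f s ≠ t) (P : MvPolynomial σ R) :
    pderiv t (rename f P) = 0 := by
  classical
  refine pderiv_eq_zero_of_notMem_vars fun ht => ?_
  obtain ⟨s, -, hs⟩ := Finset.mem_image.mp (vars_rename f P ht)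
  exact h s hs

/-- The composite of the partial derivatives with respect to the variables in a list. -/
def pderivs (R : Type) [CommRing R] (l : List σ) : Module.End R (MvPolynomial σ R) :=
  (l.map fun p => (pderiv p : Derivation R (MvPolynomial σ R) _).toLinearMap).prod

@[simp]
lemma pderivs_nil : pderivs R ([] : List σ) = 1 := rfl

lemma pderivs_cons_apply (p : σ) (l : List σ) (P : MvPolynomial σ R) :
    pderivs R (p :: l) P = pderiv p (pderivs R l P) := by
  simp [pderivs]

lemma pderivs_concat_apply (p : σ) (l : List σ) (P : MvPolynomial σ R) :
    pderivs R (l ++ [p]) P = pderivs R l (pderiv p P) := by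
  simp [pderivs]

lemma pderivs_perm {l l' : List σ} (h : l.Perm l') : pderivs R l = pderivs R l' := by
  refine (h.map _).prod_eq' (List.pairwise_map.mpr ?_)
  exact List.pairwise_of_forall fun p q => commute_pderiv p q

end General

lemma flatMap_filter_fst_perm {m : ℕ} {α : Type} [DecidableEq α] (l : List (Fin m × α)) :
    ((List.finRange m).flatMap fun s =>
      ((l.filter (·.1 = s)).map Prod.snd).map fun i => (s, i)).Perm l := by
  have h (s : Fin m) : (((l.filter (·.1 = s)).map Prod.snd).map fun i => (s, i)) =
      l.filter (·.1 = s) := by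
    rw [List.map_map]
    refine (List.map_congr_left fun p hp => ?_).trans (List.map_id _)
    have := (List.mem_filter.mp hp).2
    ext <;> simp_all
  simp only [h, List.perm_iff_count]
  intro a
  rw [List.count_flatMap, ← Fin.sum_univ_def, Finset.sum_eq_single a.1]
  · simp [List.count_filter]
  · intro b _ hb
    simp [List.count_eq_zero, Ne.symm hb]
  · simp

section PolyOp

variable {k : Type} [Field k] {N : ℕ}

/-- The operator `P ↦ x * Δ(∂^l P)` for an arbitrary prefactor `x` and an arbitrary list `l` of
derivation variables. -/
def polyOp (m n : ℕ) (x : Pn k N n) (l : List (Fin m × Fin N)) : Pn k N m →ₗ[k] Pn k N n :=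
  LinearMap.mulLeft k x ∘ₗ (spread k N m n).toLinearMap ∘ₗ pderivs k l

@[simp]
lemma polyOp_apply {m n : ℕ} (x : Pn k N n) (l : List (Fin m × Fin N)) (P : Pn k N m) :
    polyOp m n x l P = x * spread k N m n (pderivs k l P) := rfl

lemma derivOp_eq_pderivs (m : ℕ) (Is : Fin m → List (Fin N)) :
    derivOp k N m Is =
      pderivs k ((List.finRange m).flatMap fun s => (Is s).map fun i => (s, i)) := by
  unfold derivOp pderivs
  rw [List.prod_eq_foldr, List.foldr_map]
  rfl

lemma Γop_eq_polyOp (m n : ℕ) (Is : Fin m → List (Fin N)) (Js : Fin n → List (Fin N)) :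
    Γop k N m n Is Js = polyOp m n (xMon k N n Js)
      ((List.finRange m).flatMap fun s => (Is s).map fun i => (s, i)) := by
  rw [Γop, polyOp, derivOp_eq_pderivs]

lemma xMon_cons (n : ℕ) (Js : Fin n → List (Fin N)) (p : Fin n × Fin N) :
    xMon k N n (fun t => if t = p.1 then p.2 :: Js t else Js t) = X p * xMon k N n Js := by
  have h (t : Fin n) :
      ((if t = p.1 then p.2 :: Js t else Js t).map fun i => (X (t, i) : Pn k N n)).prod =
        (if t = p.1 then X p else 1) * ((Js t).map fun i => (X (t, i) : Pn k N n)).prod := by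
    split_ifs with h
    · subst h; simp
    · simp
  simp only [xMon, h, Finset.prod_mul_distrib, Finset.prod_ite_eq', Finset.mem_univ, if_true]

lemma mem_span_xMon {n : ℕ} (x : Pn k N n) : x ∈ Submodule.span k (Set.range (xMon k N n)) := by
  induction x using MvPolynomial.induction_on with
  | C a =>
    rw [C_eq_smul_one]
    exact Submodule.smul_mem _ _ (Submodule.subset_span ⟨fun _ => [], by simp [xMon]⟩)
  | add x y hx hy => exact Submodule.add_mem _ hx hy
  | mul_X x p hx =>
    induction hx using Submodule.span_induction with
    | mem x hx =>
      obtain ⟨Js, rfl⟩ := hx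
      exact Submodule.subset_span ⟨_, (xMon_cons n Js p).trans (mul_comm _ _)⟩
    | zero => simp
    | add x y _ _ hx hy => rw [add_mul]; exact Submodule.add_mem _ hx hy
    | smul a x _ hx => rw [smul_mul_assoc]; exact Submodule.smul_mem _ _ hx

lemma polyOp_mem {m n : ℕ} (x : Pn k N n) (l : List (Fin m × Fin N)) :
    polyOp m n x l ∈ polyHom k N m n := by
  have hx := mem_span_xMon x
  induction hx using Submodule.span_induction with
  | mem x hx =>
    obtain ⟨Js, rfl⟩ := hx
    refine Submodule.subset_span ⟨fun s => (l.filter (·.1 = s)).map Prod.snd, Js, ?_⟩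
    rw [Γop_eq_polyOp, polyOp, polyOp, pderivs_perm (flatMap_filter_fst_perm l)]
  | zero => convert Submodule.zero_mem _ using 1; ext; simp
  | add x y _ _ hx hy => convert Submodule.add_mem _ hx hy using 1; ext; simp [add_mul]
  | smul a x _ hx => convert Submodule.smul_mem _ a hx using 1; ext; simp

lemma polyHom_induction {m n : ℕ} {V : Type} [AddCommGroup V] [Module k V]
    (F : (Pn k N m →ₗ[k] Pn k N n) → V) (S : Submodule k V)
    (hadd : ∀ g h, F (g + h) = F g + F h) (hsmul : ∀ (a : k) g, F (a • g) = a • F g)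
    (hop : ∀ x l, F (polyOp m n x l) ∈ S) {g : Pn k N m →ₗ[k] Pn k N n}
    (hg : g ∈ polyHom k N m n) : F g ∈ S := by
  induction hg using Submodule.span_induction with
  | mem g hg =>
    obtain ⟨Is, Js, rfl⟩ := hg
    rw [Γop_eq_polyOp]
    exact hop _ _
  | zero =>
    have : F 0 = 0 := by simpa using hsmul 0 0
    exact this ▸ Submodule.zero_mem _
  | add g h _ _ hg hh => exact hadd g h ▸ Submodule.add_mem _ hg hh
  | smul a g _ hg => exact hsmul a g ▸ Submodule.smul_mem _ a hg

lemma comp_pderiv_mem {m n : ℕ} {g : Pn k N m →ₗ[k] Pn k N n} (hg : g ∈ polyHom k N m n)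
    (p : Fin m × Fin N) :
    g ∘ₗ (pderiv p : Derivation k (Pn k N m) _).toLinearMap ∈ polyHom k N m n := by
  refine polyHom_induction (fun g => g ∘ₗ (pderiv p : Derivation k (Pn k N m) _).toLinearMap) _
    (fun _ _ => LinearMap.add_comp _ _ _) (fun _ _ => LinearMap.smul_comp _ _ _)
    (fun x l => ?_) hg
  convert polyOp_mem x (l ++ [p]) using 1
  refine LinearMap.ext fun P => ?_
  simp [pderivs_concat_apply]

lemma spread_rename {m m' n : ℕ} (φ : Fin m' → Fin m) (P : Pn k N m') :
    spread k N m n (rename (Prod.map φ id) P) = spread k N m' n P := by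
  simp only [spread, aeval_rename]
  rfl

lemma polyOp_comp_rename_mem {m m' n : ℕ} (φ : Fin m' → Fin m) (x : Pn k N n)
    (l : List (Fin m × Fin N)) :
    polyOp m n x l ∘ₗ (rename (R := k) (Prod.map φ (id : Fin N → Fin N))).toLinearMap ∈
      polyHom k N m' n := by
  induction l using List.reverseRecOn with
  | nil =>
    convert polyOp_mem x ([] : List (Fin m' × Fin N)) using 1
    refine LinearMap.ext fun P => ?_
    simp [spread_rename]
  | append_singleton l p h =>
    have := Submodule.sum_mem _
      fun s (_ : s ∈ ({s | Prod.map φ id s = p} : Finset (Fin m' × Fin N))) => comp_pderiv_mem h s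
    convert this using 1
    refine LinearMap.ext fun P => ?_
    simp [pderivs_concat_apply, pderiv_rename_eq_sum, Finset.mul_sum, LinearMap.sum_apply]

/-- Inclusion of `B` as the tensor factor in slot `c`. -/
abbrev slot (n : ℕ) (c : Fin n) : MvPolynomial (Fin N) k →ₐ[k] Pn k N n :=
  rename fun i => (c, i)

/-- Inclusion of `B^{⊗n}` as the tensor factors in all slots but `c`. -/
abbrev skip (n : ℕ) (c : Fin (n + 1)) : Pn k N n →ₐ[k] Pn k N (n + 1) :=
  rename (Prod.map c.succAbove id)

lemma monomial_eq_slot_mul_skip {m : ℕ} (c : Fin (m + 1)) (μ : (Fin (m + 1) × Fin N) →₀ ℕ)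
    (α : Fin N →₀ ℕ) (β : (Fin m × Fin N) →₀ ℕ) (hα : ∀ i, α i = μ (c, i))
    (hβ : ∀ s i, β (s, i) = μ (c.succAbove s, i)) :
    (monomial μ 1 : Pn k N (m + 1)) =
      slot (m + 1) c (monomial α 1) * skip m c (monomial β 1) := by
  rw [rename_monomial, rename_monomial, monomial_mul, one_mul]
  refine congrArg (fun ν => monomial ν (1 : k)) ?_
  have hs : Function.Injective fun i : Fin N => (c, i) := Prod.mk_right_injective c
  have hk : Function.Injective (Prod.map c.succAbove (id : Fin N → Fin N)) :=
    Fin.succAbove_right_injective.prodMap Function.injective_id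
  ext ⟨s, i⟩
  obtain rfl | ⟨t, rfl⟩ := Fin.eq_self_or_eq_succAbove c s
  · rw [Finsupp.add_apply, Finsupp.mapDomain_apply hs, Finsupp.mapDomain_of_notMem_range, hα,
      add_zero]
    rintro ⟨q, hq⟩
    exact Fin.succAbove_ne _ _ (congrArg Prod.fst hq)
  · rw [Finsupp.add_apply, Finsupp.mapDomain_of_notMem_range, zero_add, ← hβ]
    · exact (Finsupp.mapDomain_apply hk β (t, i)).symm
    · rintro ⟨q, hq⟩
      exact Fin.succAbove_ne _ _ (congrArg Prod.fst hq).symm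

lemma pderivs_slot_mul_skip {m : ℕ} (c : Fin (m + 1)) (l : List (Fin m × Fin N))
    (a : MvPolynomial (Fin N) k) (b : Pn k N m) :
    pderivs k (l.map (Prod.map c.succAbove id)) (slot (m + 1) c a * skip m c b) =
      slot (m + 1) c a * skip m c (pderivs k l b) := by
  induction l with
  | nil => simp
  | cons p l ih =>
    rw [List.map_cons, pderivs_cons_apply, pderivs_cons_apply, ih, pderiv_mul,
      pderiv_rename_of_forall_ne, zero_mul, zero_add, pderiv_rename]
    · exact Fin.succAbove_right_injective.prodMap Function.injective_id
    · exact fun i h => Fin.succAbove_ne _ _ (congrArg Prod.fst h).symm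

lemma spread_slot {m n : ℕ} (c : Fin m) (a : MvPolynomial (Fin N) k) :
    spread k N m n (slot m c a) = Δiter k N n a := by
  simp only [spread, aeval_rename]
  rfl

/-- Multiplying `polyOp m n x l` by `Δ` of an extra tensor factor in slot `c` gives an operator of
the form `polyOp`. -/
lemma polyOp_map_succAbove_apply {m n : ℕ} (c : Fin (m + 1)) (x : Pn k N n)
    (l : List (Fin m × Fin N)) (a : MvPolynomial (Fin N) k) (b : Pn k N m) :
    polyOp (m + 1) n x (l.map (Prod.map c.succAbove id)) (slot (m + 1) c a * skip m c b) =
      Δiter k N n a * polyOp m n x l b := by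
  rw [polyOp_apply, pderivs_slot_mul_skip, map_mul, spread_slot, spread_rename, polyOp_apply]
  ring

/-- The algebra map `id ⊗ spread : B ⊗ B^{⊗m} → B ⊗ B^{⊗n}`, with the extra factors placed in
slots `c` and `d`. -/
def spreadSlot (m n : ℕ) (c : Fin (m + 1)) (d : Fin (n + 1)) :
    Pn k N (m + 1) →ₐ[k] Pn k N (n + 1) :=
  aeval fun p => if p.1 = c then X (d, p.2) else ∑ t : Fin n, X (d.succAbove t, p.2)

lemma spreadSlot_slot {m n : ℕ} (c : Fin (m + 1)) (d : Fin (n + 1)) (a : MvPolynomial (Fin N) k) :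
    spreadSlot m n c d (slot (m + 1) c a) = slot (n + 1) d a := by
  rw [← AlgHom.comp_apply]
  congr 1
  ext i : 1
  simp [spreadSlot]

lemma spreadSlot_skip {m n : ℕ} (c : Fin (m + 1)) (d : Fin (n + 1)) (b : Pn k N m) :
    spreadSlot m n c d (skip m c b) = skip n d (spread k N m n b) := by
  rw [← AlgHom.comp_apply, ← AlgHom.comp_apply]
  congr 1
  ext p : 1
  simp [spreadSlot, spread, Fin.succAbove_ne]

/-- The left (`c = 0`) or right (`c` the last slot) `B`-comodule structure of `B^{⊗m}`. -/
def coact (m : ℕ) (c : Fin (m + 1)) : Pn k N m →ₐ[k] Pn k N (m + 1) :=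
  aeval fun p => X (c, p.2) + X (c.succAbove p.1, p.2)

lemma pderiv_coact {m : ℕ} (c : Fin (m + 1)) (p : Fin m × Fin N) (P : Pn k N m) :
    pderiv (Prod.map c.succAbove id p) (coact m c P) = coact m c (pderiv p P) := by
  classical
  induction P using MvPolynomial.induction_on with
  | C a => simp [coact]
  | add P Q hP hQ => simp [hP, hQ]
  | mul_X P q h =>
    have hX : pderiv (Prod.map c.succAbove id p) (coact (k := k) m c (X q)) =
        coact m c (pderiv p (X q)) := by
      obtain ⟨s, i⟩ := p
      obtain ⟨t, j⟩ := q
      simp only [coact, aeval_X, map_add, pderiv_X, Pi.single_apply, Prod.map, id, Prod.mk.injEq,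
        Fin.succAbove_right_inj, (Fin.succAbove_ne c s).symm]
      split_ifs <;> simp_all
    simp only [map_mul, Derivation.leibniz, smul_eq_mul, map_add, h, hX]

lemma pderivs_coact {m : ℕ} (c : Fin (m + 1)) (l : List (Fin m × Fin N)) (P : Pn k N m) :
    pderivs k (l.map (Prod.map c.succAbove id)) (coact m c P) = coact m c (pderivs k l P) := by
  induction l with
  | nil => simp
  | cons p l ih => rw [List.map_cons, pderivs_cons_apply, pderivs_cons_apply, ih, pderiv_coact]

lemma spreadSlot_coact {m n : ℕ} (c : Fin (m + 1)) (d : Fin (n + 1)) (P : Pn k N m) :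
    spreadSlot m n c d (coact m c P) = spread k N m (n + 1) P := by
  rw [← AlgHom.comp_apply]
  congr 1
  ext p : 1
  simp [spreadSlot, spread, coact, Fin.succAbove_ne, Fin.sum_univ_succAbove _ d]

/-- If `E` agrees with `id ⊗ polyOp m n x l` on pure tensors, its composite with the coaction is
polydifferential. -/
lemma comp_coact_mem {m n : ℕ} (c : Fin (m + 1)) (d : Fin (n + 1)) (x : Pn k N n)
    (l : List (Fin m × Fin N)) (E : Pn k N (m + 1) →ₗ[k] Pn k N (n + 1))
    (α : ((Fin (m + 1) × Fin N) →₀ ℕ) → Fin N →₀ ℕ)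
    (β : ((Fin (m + 1) × Fin N) →₀ ℕ) → (Fin m × Fin N) →₀ ℕ)
    (hα : ∀ μ i, α μ i = μ (c, i)) (hβ : ∀ μ s i, β μ (s, i) = μ (c.succAbove s, i))
    (hE : ∀ μ, E (monomial μ 1) =
      slot (n + 1) d (monomial (α μ) 1) * skip n d (polyOp m n x l (monomial (β μ) 1))) :
    E ∘ₗ (coact m c).toLinearMap ∈ polyHom k N m (n + 1) := by
  have h : E = LinearMap.mulLeft k (skip n d x) ∘ₗ (spreadSlot m n c d).toLinearMap ∘ₗ
      pderivs k (l.map (Prod.map c.succAbove id)) := by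
    refine (basisMonomials _ k).ext fun μ => ?_
    rw [show basisMonomials _ k μ = monomial μ 1 from rfl, hE, LinearMap.comp_apply,
      LinearMap.comp_apply,
      monomial_eq_slot_mul_skip c μ (α μ) (β μ) (hα μ) (hβ μ), pderivs_slot_mul_skip,
      AlgHom.toLinearMap_apply, map_mul, spreadSlot_slot, spreadSlot_skip, polyOp_apply, map_mul,
      LinearMap.mulLeft_apply]
    ring
  convert polyOp_mem (skip n d x) l using 1
  refine LinearMap.ext fun P => ?_
  simp [h, pderivs_coact, spreadSlot_coact]

lemma coface_spread {m n : ℕ} (i : Fin n) (P : Pn k N m) :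
    coface k N n i (spread k N m n P) = spread k N m (n + 1) P := by
  rw [← AlgHom.comp_apply]
  congr 1
  ext p : 1
  have h (t : Fin n) : (if t = i then X (i.castSucc, p.2) + X (i.succ, p.2)
      else X (i.castSucc.succAbove t, p.2) : Pn k N (n + 1)) =
      (if t = i then X (i.castSucc, p.2) else 0) + X (i.castSucc.succAbove t, p.2) := by
    split_ifs with ht
    · rw [ht, Fin.succAbove_castSucc_self]
    · rw [zero_add]
  simp [coface, spread, h, Finset.sum_add_distrib, Fin.sum_univ_succAbove _ i.castSucc]

lemma termA_mem {m n : ℕ} {g : Pn k N m →ₗ[k] Pn k N n} (hg : g ∈ polyHom k N m n) :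
    termA k N m n g ∈ polyHom k N (m + 1) n := by
  refine polyHom_induction (termA k N m n) _ (fun g h => ?_) (fun a g => ?_) (fun x l => ?_) hg
  · refine (basisMonomials _ k).ext fun μ => ?_
    simp only [termA, Module.Basis.constr_basis, LinearMap.add_apply, mul_add]
  · refine (basisMonomials _ k).ext fun μ => ?_
    simp only [termA, Module.Basis.constr_basis, LinearMap.smul_apply, mul_smul_comm]
  · convert polyOp_mem x (l.map (Prod.map (0 : Fin (m + 1)).succAbove id)) using 1
    refine (basisMonomials _ k).ext fun μ => ?_
    rw [termA, Module.Basis.constr_basis,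
      show basisMonomials _ k μ = monomial μ 1 from rfl,
      monomial_eq_slot_mul_skip 0 μ (frontExp N m μ)
      (restExp N m μ) (fun i => rfl) (fun s i => rfl), polyOp_map_succAbove_apply]

lemma termC_mem {m n : ℕ} {g : Pn k N m →ₗ[k] Pn k N n} (hg : g ∈ polyHom k N m n) :
    termC k N m n g ∈ polyHom k N (m + 1) n := by
  refine polyHom_induction (termC k N m n) _ (fun g h => ?_) (fun a g => ?_) (fun x l => ?_) hg
  · refine (basisMonomials _ k).ext fun μ => ?_
    simp only [termC, Module.Basis.constr_basis, LinearMap.add_apply, add_mul]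
  · refine (basisMonomials _ k).ext fun μ => ?_
    simp only [termC, Module.Basis.constr_basis, LinearMap.smul_apply, smul_mul_assoc]
  · convert polyOp_mem x (l.map (Prod.map (Fin.last m).succAbove id)) using 1
    refine (basisMonomials _ k).ext fun μ => ?_
    rw [termC, Module.Basis.constr_basis,
      show basisMonomials _ k μ = monomial μ 1 from rfl,
      monomial_eq_slot_mul_skip (Fin.last m) μ
      (lastExp N m μ) (initExp N m μ) (fun i => rfl)
      (fun s i => by rw [Fin.succAbove_last]; rfl), polyOp_map_succAbove_apply, mul_comm]

lemma lextend_comp_lam_mem {m n : ℕ} {g : Pn k N m →ₗ[k] Pn k N n} (hg : g ∈ polyHom k N m n) :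
    lextend k N m n g ∘ₗ (lam k N m).toLinearMap ∈ polyHom k N m (n + 1) := by
  refine polyHom_induction (fun g => lextend k N m n g ∘ₗ (lam k N m).toLinearMap) _
    (fun g h => ?_) (fun a g => ?_) (fun x l => ?_) hg
  · rw [← LinearMap.add_comp]
    congr 1
    refine (basisMonomials _ k).ext fun μ => ?_
    simp only [lextend, Module.Basis.constr_basis, LinearMap.add_apply, map_add, mul_add]
  · rw [← LinearMap.smul_comp]
    congr 1
    refine (basisMonomials _ k).ext fun μ => ?_
    simp only [lextend, Module.Basis.constr_basis, LinearMap.smul_apply, map_smul, mul_smul_comm]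
  · refine comp_coact_mem 0 0 x l _ (frontExp N m) (restExp N m) (fun _ _ => rfl)
      (fun _ _ _ => rfl) fun μ => ?_
    rw [show monomial μ 1 = basisMonomials _ k μ from rfl, lextend, Module.Basis.constr_basis,
      rename_monomial]
    rfl

lemma rextend_comp_rhoC_mem {m n : ℕ} {g : Pn k N m →ₗ[k] Pn k N n} (hg : g ∈ polyHom k N m n) :
    rextend k N m n g ∘ₗ (rhoC k N m).toLinearMap ∈ polyHom k N m (n + 1) := by
  refine polyHom_induction (fun g => rextend k N m n g ∘ₗ (rhoC k N m).toLinearMap) _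
    (fun g h => ?_) (fun a g => ?_) (fun x l => ?_) hg
  · rw [← LinearMap.add_comp]
    congr 1
    refine (basisMonomials _ k).ext fun μ => ?_
    simp only [rextend, Module.Basis.constr_basis, LinearMap.add_apply, map_add, add_mul]
  · rw [← LinearMap.smul_comp]
    congr 1
    refine (basisMonomials _ k).ext fun μ => ?_
    simp only [rextend, Module.Basis.constr_basis, LinearMap.smul_apply, map_smul, smul_mul_assoc]
  · have hρ : rhoC k N m = coact m (Fin.last m) := by
      ext p : 1
      simp [rhoC, coact, add_comm]
    rw [hρ]
    refine comp_coact_mem (Fin.last m) (Fin.last n) x l _ (lastExp N m) (initExp N m)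
      (fun _ _ => rfl) (fun _ _ _ => by rw [Fin.succAbove_last]; rfl) fun μ => ?_
    rw [show monomial μ 1 = basisMonomials _ k μ from rfl, rextend, Module.Basis.constr_basis,
      rename_monomial, mul_comm, skip,
      Fin.succAbove_last]

lemma comp_rename_mem {m m' n : ℕ} {g : Pn k N m →ₗ[k] Pn k N n} (hg : g ∈ polyHom k N m n)
    (φ : Fin m' → Fin m) :
    g ∘ₗ (rename (R := k) (Prod.map φ (id : Fin N → Fin N))).toLinearMap ∈ polyHom k N m' n :=
  polyHom_induction
    (fun g => g ∘ₗ (rename (R := k) (Prod.map φ (id : Fin N → Fin N))).toLinearMap) _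
    (fun _ _ => LinearMap.add_comp _ _ _) (fun _ _ => LinearMap.smul_comp _ _ _)
    (polyOp_comp_rename_mem φ) hg

lemma coface_comp_mem {m n : ℕ} {g : Pn k N m →ₗ[k] Pn k N n} (hg : g ∈ polyHom k N m n)
    (i : Fin n) : (coface k N n i).toLinearMap ∘ₗ g ∈ polyHom k N m (n + 1) := by
  refine polyHom_induction (fun g => (coface k N n i).toLinearMap ∘ₗ g) _
    (fun _ _ => LinearMap.comp_add _ _ _) (fun _ _ => LinearMap.comp_smul _ _ _)
    (fun x l => ?_) hg
  convert polyOp_mem (coface k N n i x) l using 1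
  refine LinearMap.ext fun P => ?_
  simp [coface_spread]

end PolyOp

/-- Lemma 4.1 of the paper, first part. For all `m, n ≥ 1`, the
Gerstenhaber–Schack differentials `d₁` and `d₂` map polydifferential operators to
polydifferential operators; hence `⊕_{m,n≥1} Hom_poly(B^{⊗m}, B^{⊗n})` is a subcomplex
of the Gerstenhaber–Schack complex of the bialgebra `B`. -/
theorem gs_poly_subcomplex (m n : ℕ) (hm : 1 ≤ m) (hn : 1 ≤ n)
    (g : Pn k N m →ₗ[k] Pn k N n) (hg : g ∈ polyHom k N m n) :
    d1 k N m n g ∈ polyHom k N (m + 1) n ∧ d2 k N m n g ∈ polyHom k N m (n + 1) := by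
  refine ⟨?_, ?_⟩
  · refine Submodule.add_mem _ (Submodule.add_mem _ (termA_mem hg) ?_)
      (Submodule.smul_mem _ _ (termC_mem hg))
    exact Submodule.sum_mem _ fun i _ => Submodule.smul_mem _ _ (comp_rename_mem hg _)
  · refine Submodule.add_mem _ (Submodule.add_mem _ (lextend_comp_lam_mem hg) ?_)
      (Submodule.smul_mem _ _ (rextend_comp_rhoC_mem hg))
    exact Submodule.sum_mem _ fun i _ => Submodule.smul_mem _ _ (coface_comp_mem hg i)

end GS
end
end

section
/- {γ_δ, γ_δ} = 0 in A if and only if δ satisfies the co-Jacobi identity: (δ⊗id)δ(a) + τ((δ⊗id)δ(a)) + τ²((δ⊗id)δ(a)) = 0 in V⊗V⊗V for all a ∈ V, where τ is the cyclic permutation (123) acting naturally on V⊗V⊗V. -/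
noncomputable section

open TensorProduct

namespace BigBracket

variable (k : Type) [Field k] [CharZero k]
variable (V : Type) [AddCommGroup V] [Module k V] [FiniteDimensional k V]

/-- The exterior algebra `A = Λ(V ⊕ V*)`, graded by exterior degree. -/
abbrev A : Type := ExteriorAlgebra k (V × Module.Dual k V)

/-- The canonical degree-one inclusion of `V` into `A`. -/
def ιV : V →ₗ[k] A k V :=
  (ExteriorAlgebra.ι k).comp (LinearMap.inl k V (Module.Dual k V))

/-- The canonical degree-one inclusion of `V*` into `A`. -/
def ιD : Module.Dual k V →ₗ[k] A k V :=
  (ExteriorAlgebra.ι k).comp (LinearMap.inr k V (Module.Dual k V))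

/-- The degree-`p` homogeneous component `A^p` of `A = Λ(V ⊕ V*)`. -/
def deg (p : ℕ) : Submodule k (A k V) :=
  (LinearMap.range (ExteriorAlgebra.ι k : (V × Module.Dual k V) →ₗ[k] A k V)) ^ p

/-- The defining properties (a)–(d) of the big bracket `{·,·} : A × A → A`:
(a) `{A^p, A^q} ⊆ A^{p+q-2}`;
(b) `{v,w} = 0`, `{α,β} = 0`, `{α,v} = {v,α} = ⟨α,v⟩` for `v,w ∈ V`, `α,β ∈ V*`, and
    `{1,a} = 0`;
(c) for homogeneous `a ∈ A^p`, the map `{a,·}` is a graded derivation: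
    `{a, b∧c} = {a,b}∧c + (-1)^{(p-2)q} b∧{a,c}` for homogeneous `b ∈ A^q` and all `c`;
(d) graded antisymmetry `{a,b} = -(-1)^{(p-2)(q-2)} {b,a}`. -/
structure IsBigBracket (br : A k V →ₗ[k] A k V →ₗ[k] A k V) : Prop where
  mem_deg : ∀ (p q : ℕ) (a b : A k V), a ∈ deg k V p → b ∈ deg k V q →
    br a b ∈ deg k V (p + q - 2)
  ιV_ιV : ∀ v w : V, br (ιV k V v) (ιV k V w) = 0
  ιD_ιD : ∀ α β : Module.Dual k V, br (ιD k V α) (ιD k V β) = 0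
  ιD_ιV : ∀ (α : Module.Dual k V) (v : V),
    br (ιD k V α) (ιV k V v) = algebraMap k (A k V) (α v)
  ιV_ιD : ∀ (v : V) (α : Module.Dual k V),
    br (ιV k V v) (ιD k V α) = algebraMap k (A k V) (α v)
  one_left : ∀ a : A k V, br 1 a = 0
  derivation : ∀ (p : ℕ) (a : A k V), a ∈ deg k V p → ∀ (q : ℕ) (b : A k V), b ∈ deg k V q →
    ∀ c : A k V,
      br a (b * c) = br a b * c + ((-1 : k) ^ (((p : ℤ) - 2) * (q : ℤ))) • (b * br a c)
  antisymm : ∀ (p : ℕ) (a : A k V), a ∈ deg k V p → ∀ (q : ℕ) (b : A k V), b ∈ deg k V q →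
    br a b = -(((-1 : k) ^ (((p : ℤ) - 2) * ((q : ℤ) - 2))) • br b a)

/-- The subspace `Λ²V* ∧ V ⊆ A³`, spanned by the products `α∧β∧v`. -/
def muSpan : Submodule k (A k V) :=
  Submodule.span k
    {x | ∃ (α β : Module.Dual k V) (v : V), x = ιD k V α * ιD k V β * ιV k V v}

/-- The subspace `V* ∧ Λ²V ⊆ A³`, spanned by the products `α∧u∧w`. -/
def deltaSpan : Submodule k (A k V) :=
  Submodule.span k
    {x | ∃ (α : Module.Dual k V) (u w : V), x = ιD k V α * ιV k V u * ιV k V w}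

/-- `γμ ∈ A³` is the element corresponding to the (antisymmetric bilinear encoding `br2` of
the) linear map `μ : Λ²V → V` via the canonical isomorphism `Hom(Λ²V, V) ≅ Λ²V* ⊗ V` and the
embedding `(α∧β)⊗v ↦ α∧β∧v`: equivalently, `γμ` lies in the span of the products `α∧β∧v` and
satisfies `{b, {a, γμ}} = [a,b]` for all `a, b ∈ V` (here `[a,b] = μ(a∧b) = br2 a b`). -/
def RepresentsBracket (br : A k V →ₗ[k] A k V →ₗ[k] A k V)
    (br2 : V →ₗ[k] V →ₗ[k] V) (γμ : A k V) : Prop :=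
  γμ ∈ muSpan k V ∧
    ∀ a b : V, br (ιV k V b) (br (ιV k V a) γμ) = ιV k V (br2 a b)

/-- `γδ ∈ A³` is the element corresponding to the linear map `δ : V → Λ²V` (encoded as an
antisymmetric map `δ : V → V⊗V` via `u∧w ↦ u⊗w - w⊗u`) via the canonical isomorphism
`Hom(V, Λ²V) ≅ V* ⊗ Λ²V` and the embedding `α⊗(u∧w) ↦ α∧u∧w`: equivalently, `γδ` lies in the
span of the products `α∧u∧w` and satisfies `{a, γδ} = δ(a)` in `Λ²V ⊂ A²` for all `a ∈ V`
(the factor `2` accounts for the encoding `u∧w ↦ u⊗w - w⊗u`, since `u∧w` maps to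
`(1/2)(ι(u)ι(w) - ι(w)ι(u))` under it). -/
def RepresentsCobracket (br : A k V →ₗ[k] A k V →ₗ[k] A k V)
    (δ : V →ₗ[k] V ⊗[k] V) (γδ : A k V) : Prop :=
  γδ ∈ deltaSpan k V ∧
    ∀ a : V,
      (LinearMap.mul' k (A k V)) ((TensorProduct.map (ιV k V) (ιV k V)) (δ a))
        = (2 : k) • br (ιV k V a) γδ

/-- The Jacobi identity `[a,[b,c]] = [[a,b],c] + [b,[a,c]]`. -/
def LieJacobi (br2 : V →ₗ[k] V →ₗ[k] V) : Prop :=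
  ∀ a b c : V, br2 a (br2 b c) = br2 (br2 a b) c + br2 b (br2 a c)

/-- A cyclic permutation `τ` of `V⊗V⊗V`. -/
def cyc : (V ⊗[k] V) ⊗[k] V ≃ₗ[k] (V ⊗[k] V) ⊗[k] V :=
  (TensorProduct.assoc k V V V).trans (TensorProduct.comm k V (V ⊗[k] V))

/-- The co-Jacobi identity `(δ⊗id)δ(a) + τ((δ⊗id)δ(a)) + τ²((δ⊗id)δ(a)) = 0` in `V⊗V⊗V`
(being a sum over the cyclic group, this is independent of the choice of generator `τ`). -/
def CoJacobi (δ : V →ₗ[k] V ⊗[k] V) : Prop :=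
  ∀ a : V,
    (LinearMap.rTensor V δ) (δ a) + cyc k V ((LinearMap.rTensor V δ) (δ a))
      + cyc k V (cyc k V ((LinearMap.rTensor V δ) (δ a))) = 0

/-- The encoding `Λ²V → V⊗V`, `x∧y ↦ x⊗y - y⊗x`, applied to a decomposable element `x⊗y`. -/
def wedgeify : V ⊗[k] V →ₗ[k] V ⊗[k] V :=
  LinearMap.id - (TensorProduct.comm k V V).toLinearMap

/-- The Leibniz-type compatibility identity (condition (iii) of §2.1 of the paper):
`δ([a,b]) = Σ a₍₁₎∧[a₍₂₎,b] - Σ a₍₂₎∧[a₍₁₎,b] + Σ [a,b₍₁₎]∧b₍₂₎ - Σ [a,b₍₂₎]∧b₍₁₎` in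
`Λ²V ⊂ V⊗V`, where `δ(a) = Σ a₍₁₎ ⊗ a₍₂₎` and `x∧y` is encoded as `x⊗y - y⊗x`. -/
def Compat (br2 : V →ₗ[k] V →ₗ[k] V) (δ : V →ₗ[k] V ⊗[k] V) : Prop :=
  ∀ a b : V,
    δ (br2 a b) =
      wedgeify k V ((LinearMap.lTensor V (br2.flip b)) (δ a))
        - wedgeify k V ((LinearMap.lTensor V (br2.flip b)) ((TensorProduct.comm k V V) (δ a)))
        + wedgeify k V ((LinearMap.rTensor V (br2 a)) (δ b))
        - wedgeify k V ((LinearMap.rTensor V (br2 a)) ((TensorProduct.comm k V V) (δ b)))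

section Auxiliary

variable {k : Type} [Field k]
variable {V : Type} [AddCommGroup V] [Module k V]

theorem ιV_mem_deg (v : V) : ιV k V v ∈ deg k V 1 := by
  simp [deg, ιV]

theorem ιD_mem_deg (α : Module.Dual k V) : ιD k V α ∈ deg k V 1 := by
  simp [deg, ιD]

theorem deltaSpan_le_deg : deltaSpan k V ≤ deg k V 3 := by
  refine Submodule.span_le.2 ?_
  rintro _ ⟨α, u, w, rfl⟩
  have h : deg k V 3 = deg k V 1 * deg k V 1 * deg k V 1 := by
    simp only [deg, pow_succ, pow_zero, one_mul]
  rw [h]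
  exact Submodule.mul_mem_mul
    (Submodule.mul_mem_mul (ιD_mem_deg α) (ιV_mem_deg u)) (ιV_mem_deg w)

theorem ιV_mul_ιV_swap (u w : V) : ιV k V u * ιV k V w = -(ιV k V w * ιV k V u) :=
  eq_neg_of_add_eq_zero_left (ExteriorAlgebra.ι_add_mul_swap _ _)

variable (k V) in
/-- The product `u ⊗ w ↦ u ∧ w` from `V ⊗ V` to `A`. -/
def wedge₂ : V ⊗[k] V →ₗ[k] A k V :=
  (LinearMap.mul' k (A k V)).comp (TensorProduct.map (ιV k V) (ιV k V))

variable (k V) in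
/-- The product `u ⊗ w ⊗ x ↦ u ∧ w ∧ x` from `V ⊗ V ⊗ V` to `A`. -/
def wedge₃ : (V ⊗[k] V) ⊗[k] V →ₗ[k] A k V :=
  (LinearMap.mul' k (A k V)).comp (TensorProduct.map (wedge₂ k V) (ιV k V))

@[simp]
theorem wedge₂_tmul (u w : V) : wedge₂ k V (u ⊗ₜ w) = ιV k V u * ιV k V w := rfl

@[simp]
theorem wedge₃_tmul (t : V ⊗[k] V) (x : V) :
    wedge₃ k V (t ⊗ₜ x) = wedge₂ k V t * ιV k V x := rfl

theorem commute_ιV_wedge₂ (v : V) (t : V ⊗[k] V) : Commute (ιV k V v) (wedge₂ k V t) := by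
  induction t with
  | zero => simp
  | add s t hs ht => rw [map_add]; exact hs.add_right ht
  | tmul u w =>
    rw [wedge₂_tmul, commute_iff_eq, ← mul_assoc, ιV_mul_ιV_swap v u, neg_mul, mul_assoc,
      ιV_mul_ιV_swap v w, mul_neg, neg_neg, mul_assoc]

theorem cyc_tmul (u w x : V) : cyc k V ((u ⊗ₜ w) ⊗ₜ x) = (w ⊗ₜ x) ⊗ₜ u := rfl

theorem wedge₃_cyc (t : (V ⊗[k] V) ⊗[k] V) : wedge₃ k V (cyc k V t) = wedge₃ k V t := by
  suffices h : (wedge₃ k V).comp (cyc k V).toLinearMap = wedge₃ k V from LinearMap.congr_fun h t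
  refine TensorProduct.ext_threefold fun u w x => ?_
  have h := commute_ιV_wedge₂ u (w ⊗ₜ[k] x)
  rw [wedge₂_tmul, commute_iff_eq] at h
  simp [cyc_tmul, ← h, mul_assoc]

variable (k V) in
/-- The trilinear map `(u, w, x) ↦ u ⊗ w ⊗ x`. -/
def tmul₃ : MultilinearMap k (fun _ : Fin 3 => V) ((V ⊗[k] V) ⊗[k] V) :=
  MultilinearMap.mk' (fun v => (v 0 ⊗ₜ v 1) ⊗ₜ v 2)
    (fun v i x y => by
      fin_cases i <;> simp [TensorProduct.add_tmul, TensorProduct.tmul_add])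
    (fun v i c x => by
      fin_cases i <;> simp [TensorProduct.smul_tmul', TensorProduct.tmul_smul])

theorem alternatization_tmul₃ (v : Fin 3 → V) :
    (tmul₃ k V).alternatization v =
      (v 0 ⊗ₜ v 1) ⊗ₜ v 2 + (v 1 ⊗ₜ v 2) ⊗ₜ v 0 + (v 2 ⊗ₜ v 0) ⊗ₜ v 1
        - ((v 1 ⊗ₜ v 0) ⊗ₜ v 2 + (v 0 ⊗ₜ v 2) ⊗ₜ v 1 + (v 2 ⊗ₜ v 1) ⊗ₜ v 0) := by
  have h : (Finset.univ : Finset (Equiv.Perm (Fin 3))) =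
      {1, finRotate 3, (finRotate 3)⁻¹, Equiv.swap 0 1, Equiv.swap 1 2, Equiv.swap 0 2} := by
    decide
  rw [MultilinearMap.alternatization_apply, h]
  repeat rw [Finset.sum_insert (by decide)]
  rw [Finset.sum_singleton]
  have h₁ : Equiv.Perm.sign (finRotate 3) = 1 := by decide
  have h₂ : ((finRotate 3)⁻¹ : Equiv.Perm (Fin 3)) 0 = 2 := by decide
  have h₃ : ((finRotate 3)⁻¹ : Equiv.Perm (Fin 3)) 1 = 0 := by decide
  have h₄ : ((finRotate 3)⁻¹ : Equiv.Perm (Fin 3)) 2 = 1 := by decide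
  have h₅ : (finRotate 3) 0 = 1 := by decide
  have h₆ : (finRotate 3) 1 = 2 := by decide
  have h₇ : (finRotate 3) 2 = 0 := by decide
  have h₈ : (Equiv.swap 0 1 : Equiv.Perm (Fin 3)) 2 = 2 := by decide
  have h₉ : (Equiv.swap 1 2 : Equiv.Perm (Fin 3)) 0 = 0 := by decide
  have h₀ : (Equiv.swap 0 2 : Equiv.Perm (Fin 3)) 1 = 1 := by decide
  have s₁ : Equiv.Perm.sign (Equiv.swap 0 1 : Equiv.Perm (Fin 3)) = -1 := by decide
  have s₂ : Equiv.Perm.sign (Equiv.swap 1 2 : Equiv.Perm (Fin 3)) = -1 := by decide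
  have s₃ : Equiv.Perm.sign (Equiv.swap 0 2 : Equiv.Perm (Fin 3)) = -1 := by decide
  simp only [tmul₃, map_one, map_inv, h₁, s₁, s₂, s₃, one_smul, inv_one, Units.neg_smul,
    MultilinearMap.domDomCongr_apply, MultilinearMap.mk'_apply,
    Equiv.Perm.coe_one, id_eq, h₂, h₃, h₄, h₅, h₆, h₇, h₈, h₉, h₀, Equiv.swap_apply_left,
    Equiv.swap_apply_right]
  abel

variable (k V) in
/-- The linear map `A → V ⊗ V ⊗ V` that projects `A` to `Λ³V` and antisymmetrizes. -/
def antisymmetrize : A k V →ₗ[k] (V ⊗[k] V) ⊗[k] V :=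
  ExteriorAlgebra.liftAlternating (Pi.single 3
    ((tmul₃ k V).alternatization.compLinearMap (LinearMap.fst k V (Module.Dual k V))))

theorem antisymmetrize_wedge₃ (t : (V ⊗[k] V) ⊗[k] V) :
    antisymmetrize k V (wedge₃ k V t) =
      (t - LinearMap.rTensor V (TensorProduct.comm k V V).toLinearMap t)
        + cyc k V (t - LinearMap.rTensor V (TensorProduct.comm k V V).toLinearMap t)
        + cyc k V (cyc k V
          (t - LinearMap.rTensor V (TensorProduct.comm k V V).toLinearMap t)) := by
  have h : (antisymmetrize k V).comp (wedge₃ k V) =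
      (LinearMap.id + (cyc k V).toLinearMap + (cyc k V).toLinearMap.comp (cyc k V).toLinearMap).comp
        (LinearMap.id - LinearMap.rTensor V (TensorProduct.comm k V V).toLinearMap) := by
    refine TensorProduct.ext_threefold fun u w x => ?_
    have e : wedge₃ k V ((u ⊗ₜ w) ⊗ₜ x) =
        ExteriorAlgebra.ιMulti k 3 ![((u, 0) : V × Module.Dual k V), (w, 0), (x, 0)] := by
      simp [ExteriorAlgebra.ιMulti_apply, ιV, mul_assoc]
    rw [LinearMap.comp_apply, e, antisymmetrize, ExteriorAlgebra.liftAlternating_apply_ιMulti,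
      Pi.single_eq_same, AlternatingMap.compLinearMap_apply, alternatization_tmul₃]
    simp [cyc_tmul]
    abel
  exact LinearMap.congr_fun h t

/-- For a tensor antisymmetric in its first two factors, vanishing of the image in `Λ³V` is
vanishing of the cyclic sum. -/
theorem wedge₃_eq_zero_iff [CharZero k] {t : (V ⊗[k] V) ⊗[k] V}
    (ht : LinearMap.rTensor V (TensorProduct.comm k V V).toLinearMap t = -t) :
    wedge₃ k V t = 0 ↔ t + cyc k V t + cyc k V (cyc k V t) = 0 := by
  constructor
  · intro h
    have h' := antisymmetrize_wedge₃ t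
    rw [h, map_zero, ht, sub_neg_eq_add, ← two_smul k t, map_smul, map_smul, ← smul_add,
      ← smul_add] at h'
    exact (smul_eq_zero.1 h'.symm).resolve_left two_ne_zero
  · intro h
    have h' := congrArg (wedge₃ k V) h
    simp only [map_add, wedge₃_cyc, map_zero] at h'
    have h3 : (3 : k) • wedge₃ k V t = 0 := by
      rw [← h']; module
    exact (smul_eq_zero.1 h3).resolve_left three_ne_zero

namespace IsBigBracket

variable {br : A k V →ₗ[k] A k V →ₗ[k] A k V} (hbr : IsBigBracket k V br)
include hbr

theorem one_mul_of_odd {p : ℕ} (hp : Odd p) {a b : A k V} (ha : a ∈ deg k V p)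
    (hb : b ∈ deg k V 1) (c : A k V) : br a (b * c) = br a b * c - b * br a c := by
  rw [hbr.derivation p a ha 1 b hb c, Nat.cast_one, mul_one,
    Odd.neg_one_zpow (by simpa [Int.odd_sub] using hp), neg_one_smul, sub_eq_add_neg]

theorem comm_of_odd {p q : ℕ} (hp : Odd p) (hq : Odd q) {a b : A k V} (ha : a ∈ deg k V p)
    (hb : b ∈ deg k V q) : br a b = br b a := by
  rw [hbr.antisymm p a ha q b hb,
    Odd.neg_one_zpow (Odd.mul (by simpa [Int.odd_sub] using hp) (by simpa [Int.odd_sub] using hq)),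
    neg_one_smul, neg_neg]

theorem ιV_ιD_mul (a : V) (α : Module.Dual k V) (x : A k V) :
    br (ιV k V a) (ιD k V α * x) = α a • x - ιD k V α * br (ιV k V a) x := by
  rw [hbr.one_mul_of_odd odd_one (ιV_mem_deg a) (ιD_mem_deg α), hbr.ιV_ιD, Algebra.smul_def]

theorem ιV_wedge₂ (a : V) (t : V ⊗[k] V) : br (ιV k V a) (wedge₂ k V t) = 0 := by
  induction t with
  | zero => simp
  | add s t hs ht => simp [hs, ht]
  | tmul u w =>
    simp [hbr.one_mul_of_odd odd_one (ιV_mem_deg a) (ιV_mem_deg u), hbr.ιV_ιV]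

theorem ιV_wedge₃ (a : V) (t : (V ⊗[k] V) ⊗[k] V) : br (ιV k V a) (wedge₃ k V t) = 0 := by
  suffices h : (br (ιV k V a)).comp (wedge₃ k V) = 0 from LinearMap.congr_fun h t
  refine TensorProduct.ext_threefold fun u w x => ?_
  simp [mul_assoc, hbr.one_mul_of_odd odd_one (ιV_mem_deg a) (ιV_mem_deg _), hbr.ιV_ιV]

theorem ιD_wedge₂_tmul (α : Module.Dual k V) (u w : V) :
    br (ιD k V α) (wedge₂ k V (u ⊗ₜ w)) = α u • ιV k V w - α w • ιV k V u := by
  rw [wedge₂_tmul, hbr.one_mul_of_odd odd_one (ιD_mem_deg α) (ιV_mem_deg u), hbr.ιD_ιV,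
    hbr.ιD_ιV, ← Algebra.smul_def, ← Algebra.commutes, ← Algebra.smul_def]

variable {ι : Type*} [Fintype ι] (b : Module.Basis ι k V)

theorem sum_coord_mul_wedge₃_eq_zero_iff (f : V →ₗ[k] (V ⊗[k] V) ⊗[k] V) :
    ∑ i, ιD k V (b.coord i) * wedge₃ k V (f (b i)) = 0 ↔ ∀ a, wedge₃ k V (f a) = 0 := by
  refine ⟨fun h a => ?_, fun h => by simp [h]⟩
  have h' := congrArg (br (ιV k V a)) h
  simp only [map_sum, map_zero, hbr.ιV_ιD_mul, hbr.ιV_wedge₃, mul_zero, sub_zero,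
    ← map_smul] at h'
  rw [← map_sum, ← map_sum] at h'
  simpa [b.sum_repr] using h'

theorem sum_coord_mul_bracket {γ : A k V} (hγ : γ ∈ deltaSpan k V) :
    ∑ i, ιD k V (b.coord i) * br (ιV k V (b i)) γ = γ := by
  induction hγ using Submodule.span_induction with
  | zero => simp
  | add x y _ _ hx hy => simp only [map_add, mul_add, Finset.sum_add_distrib, hx, hy]
  | smul c x _ hx => simp only [map_smul, mul_smul_comm, ← Finset.smul_sum, hx]
  | mem x hx =>
    obtain ⟨α, u, w, rfl⟩ := hx
    simp only [mul_assoc, hbr.ιV_ιD_mul]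
    simp only [← wedge₂_tmul, hbr.ιV_wedge₂, mul_zero, sub_zero, mul_smul_comm]
    simp only [← smul_mul_assoc, ← Finset.sum_mul, ← map_smul, ← map_sum]
    congr 2
    exact b.ext fun j => by simp

end IsBigBracket

namespace RepresentsCobracket

variable {br : A k V →ₗ[k] A k V →ₗ[k] A k V} {δ : V →ₗ[k] V ⊗[k] V} {γ : A k V}

theorem mem_deg (hγ : RepresentsCobracket k V br δ γ) : γ ∈ deg k V 3 :=
  deltaSpan_le_deg hγ.1

theorem two_smul_bracket (hγ : RepresentsCobracket k V br δ γ) (a : V) :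
    (2 : k) • br (ιV k V a) γ = wedge₂ k V (δ a) :=
  (hγ.2 a).symm

theorem bracket_eq [CharZero k] (hγ : RepresentsCobracket k V br δ γ) (a : V) :
    br (ιV k V a) γ = (2⁻¹ : k) • wedge₂ k V (δ a) := by
  rw [← hγ.two_smul_bracket, inv_smul_smul₀ two_ne_zero]

variable [CharZero k] (hbr : IsBigBracket k V br) (hγ : RepresentsCobracket k V br δ γ)
include hbr hγ

theorem bracket_wedge₂_tmul (u w : V) :
    br γ (wedge₂ k V (u ⊗ₜ w)) =
      br (ιV k V u) γ * ιV k V w - br (ιV k V w) γ * ιV k V u := by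
  rw [wedge₂_tmul, hbr.one_mul_of_odd (by decide) hγ.mem_deg (ιV_mem_deg u),
    hbr.comm_of_odd (by decide) odd_one hγ.mem_deg (ιV_mem_deg u),
    hbr.comm_of_odd (by decide) odd_one hγ.mem_deg (ιV_mem_deg w), hγ.bracket_eq w,
    mul_smul_comm, smul_mul_assoc, (commute_ιV_wedge₂ u (δ w)).eq]

theorem two_smul_bracket_wedge₂ (t : V ⊗[k] V) :
    (2 : k) • br γ (wedge₂ k V t) =
      wedge₃ k V (LinearMap.rTensor V δ (t - TensorProduct.comm k V V t)) := by
  induction t with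
  | zero => simp
  | add s t hs ht =>
    rw [map_add, map_add, smul_add, hs, ht, ← map_add, ← map_add, map_add (TensorProduct.comm k V V),
      add_sub_add_comm]
  | tmul u w =>
    rw [bracket_wedge₂_tmul hbr hγ, smul_sub, ← smul_mul_assoc, ← smul_mul_assoc,
      hγ.two_smul_bracket, hγ.two_smul_bracket]
    simp

theorem two_smul_bracket_bracket (hδ : ∀ a, TensorProduct.comm k V V (δ a) = -δ a) (a : V) :
    (2 : k) • br γ (br (ιV k V a) γ) = wedge₃ k V (LinearMap.rTensor V δ (δ a)) := by
  have h := two_smul_bracket_wedge₂ hbr hγ (δ a)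
  rw [hδ, sub_neg_eq_add, ← two_smul k (δ a), map_smul, map_smul] at h
  rw [hγ.bracket_eq, map_smul, smul_inv_smul₀ two_ne_zero]
  exact smul_right_injective _ (two_ne_zero (α := k)) h

variable {ι : Type*} [Fintype ι] (b : Module.Basis ι k V)

theorem sum_bracket_coord_mul_bracket (t : V ⊗[k] V) :
    ∑ i, br (ιD k V (b.coord i)) (wedge₂ k V t) * br (ιV k V (b i)) γ =
      br γ (wedge₂ k V t) := by
  induction t with
  | zero => simp
  | add s t hs ht => simp only [map_add, add_mul, Finset.sum_add_distrib, hs, ht]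
  | tmul u w =>
    have key (v : V) : ∑ i, b.coord i v • br (ιV k V (b i)) γ = br (ιV k V v) γ := by
      conv_rhs => rw [← b.sum_repr v]
      simp only [map_sum, map_smul, LinearMap.sum_apply, LinearMap.smul_apply, b.coord_apply]
    simp only [hbr.ιD_wedge₂_tmul, sub_mul, Finset.sum_sub_distrib, smul_mul_assoc]
    simp only [← mul_smul_comm, ← Finset.mul_sum, key]
    rw [bracket_wedge₂_tmul hbr hγ, hγ.bracket_eq, hγ.bracket_eq, mul_smul_comm, mul_smul_comm,
      (commute_ιV_wedge₂ _ _).eq, (commute_ιV_wedge₂ _ _).eq, smul_mul_assoc, smul_mul_assoc]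

theorem bracket_self_eq_sum :
    br γ γ = -∑ i, ιD k V (b.coord i) * ((2 : k) • br γ (br (ιV k V (b i)) γ)) := by
  have h₁ (i : ι) : br γ (ιD k V (b.coord i)) =
      -∑ j, ιD k V (b.coord j) * br (ιD k V (b.coord i)) (br (ιV k V (b j)) γ) := by
    rw [hbr.comm_of_odd (by decide) odd_one hγ.mem_deg (ιD_mem_deg _)]
    conv_lhs => rw [← hbr.sum_coord_mul_bracket b hγ.1]
    simp [hbr.one_mul_of_odd odd_one (ιD_mem_deg _) (ιD_mem_deg _), hbr.ιD_ιD]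
  have h₂ (j : ι) : ∑ i, br (ιD k V (b.coord i)) (br (ιV k V (b j)) γ) * br (ιV k V (b i)) γ =
      br γ (br (ιV k V (b j)) γ) := by
    have h := sum_bracket_coord_mul_bracket hbr hγ b (δ (b j))
    rw [hγ.bracket_eq (b j)]
    simp only [map_smul, smul_mul_assoc, ← Finset.smul_sum, h]
  have h₃ : ∑ i, br γ (ιD k V (b.coord i)) * br (ιV k V (b i)) γ =
      -∑ j, ιD k V (b.coord j) * br γ (br (ιV k V (b j)) γ) := by
    simp only [h₁, ← h₂, neg_mul, Finset.sum_mul, Finset.mul_sum, Finset.sum_neg_distrib,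
      mul_assoc]
    rw [Finset.sum_comm]
  rw [← congrArg (br γ) (hbr.sum_coord_mul_bracket b hγ.1), map_sum]
  simp only [hbr.one_mul_of_odd (by decide : Odd 3) hγ.mem_deg (ιD_mem_deg _),
    Finset.sum_sub_distrib, h₃, two_smul, mul_add, Finset.sum_add_distrib, neg_add']

end RepresentsCobracket

end Auxiliary

/-- Let `{·,·}` be the big bracket on `A = Λ(V ⊕ V*)` and let
`δ : V → Λ²V` (encoded as the antisymmetric `δ : V → V⊗V` via `u∧w ↦ u⊗w - w⊗u`)
correspond to `γδ ∈ A³`. Then `{γδ, γδ} = 0` in `A` if and only if `δ` satisfies the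
co-Jacobi identity `(δ⊗id)δ(a) + τ((δ⊗id)δ(a)) + τ²((δ⊗id)δ(a)) = 0` in `V⊗V⊗V` for all
`a ∈ V`, where `τ` is the cyclic permutation `(123)`. -/
theorem cobracket_sq_zero_iff_coJacobi
    (br : A k V →ₗ[k] A k V →ₗ[k] A k V) (hbr : IsBigBracket k V br)
    (δ : V →ₗ[k] V ⊗[k] V) (hδ : ∀ a : V, (TensorProduct.comm k V V) (δ a) = -δ a)
    (γδ : A k V) (hγδ : RepresentsCobracket k V br δ γδ) :
    br γδ γδ = 0 ↔ CoJacobi k V δ := by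
  let b := Module.finBasis k V
  rw [RepresentsCobracket.bracket_self_eq_sum hbr hγδ b, neg_eq_zero]
  simp only [RepresentsCobracket.two_smul_bracket_bracket hbr hγδ hδ]
  refine (hbr.sum_coord_mul_wedge₃_eq_zero_iff b ((LinearMap.rTensor V δ).comp δ)).trans
    (forall_congr' fun a => wedge₃_eq_zero_iff ?_)
  have h : (TensorProduct.comm k V V).toLinearMap.comp δ = -δ := LinearMap.ext hδ
  rw [LinearMap.comp_apply, ← LinearMap.rTensor_comp_apply, h, LinearMap.rTensor_neg,
    LinearMap.neg_apply]

end BigBracket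
end
end
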